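/- arXiv:1503.08350 — 2 statements merged into one kernel-verified Lean document; each statement's English description precedes it below -/
import Mathlib

section
/- For each i = 1, 2, 3, the fundamental 2-form Fᵢ(X, Y) := g_λ(X, φᵢY) of the almost contact structure (φᵢ, ξᵢ, ηᵢ) on n_p is not closed: there exist X, Y, Z ∈ n_p with dFᵢ(X, Y, Z) := −Fᵢ([X, Y], Z) − Fᵢ([Y, Z], X) − Fᵢ([Z, X], Y) ≠ 0. In particular, none of the three normal almost contact structures φᵢ is quasi-Sasakian. -/
/-! Common setup: the quaternionic Heisenberg Lie algebra `n_p` of dimension `4p+3`,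
realised as `ℝ^{4p+3}` with orthonormal basis `ξ₁ ξ₂ ξ₃ τ₁ … τ_{4p}`. -/

noncomputable section

open scoped BigOperators

/-- The underlying vector space of the quaternionic Heisenberg Lie algebra `n_p`. -/
abbrev NV (p : ℕ) : Type := Fin (4 * p + 3) → ℝ

/-- The inner product `g_λ` for which the standard basis is orthonormal. -/
def gIP {p : ℕ} (X Y : NV p) : ℝ := ∑ a, X a * Y a

/-- Index of the basis vector `ξ_{i+1}`, `i = 0, 1, 2`. -/
def zI (p : ℕ) (i : Fin 3) : Fin (4 * p + 3) := ⟨i.val, by have := i.isLt; omega⟩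

/-- Index of the basis vector `τ_{ip + r + 1}`, `i = 0, 1, 2, 3`, `r = 0, …, p-1`. -/
def tI (p : ℕ) (i : Fin 4) (r : Fin p) : Fin (4 * p + 3) :=
  ⟨3 + i.val * p + r.val, by
    have h1 := i.isLt; have h2 := r.isLt
    have h3 : i.val * p ≤ 3 * p := Nat.mul_le_mul_right p (by omega)
    omega⟩

/-- The basis vector `ξ_{i+1}`. -/
def xi (p : ℕ) (i : Fin 3) : NV p := Pi.single (zI p i) 1

/-- The basis vector `τ_{ip + r + 1}`. -/
def tau (p : ℕ) (i : Fin 4) (r : Fin p) : NV p := Pi.single (tI p i r) 1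

/-- The Lie bracket of `n_p`: the bilinear extension of
`[τ_r, τ_{p+r}] = [τ_{2p+r}, τ_{3p+r}] = λ ξ₁`, `[τ_r, τ_{2p+r}] = [τ_{3p+r}, τ_{p+r}] = λ ξ₂`,
`[τ_r, τ_{3p+r}] = [τ_{p+r}, τ_{2p+r}] = λ ξ₃`, all other brackets of basis vectors being zero. -/
def bracket (p : ℕ) (lam : ℝ) (X Y : NV p) : NV p :=
  (lam * ∑ r : Fin p,
      (X (tI p 0 r) * Y (tI p 1 r) - X (tI p 1 r) * Y (tI p 0 r)
        + X (tI p 2 r) * Y (tI p 3 r) - X (tI p 3 r) * Y (tI p 2 r))) • xi p 0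
  + (lam * ∑ r : Fin p,
      (X (tI p 0 r) * Y (tI p 2 r) - X (tI p 2 r) * Y (tI p 0 r)
        + X (tI p 3 r) * Y (tI p 1 r) - X (tI p 1 r) * Y (tI p 3 r))) • xi p 1
  + (lam * ∑ r : Fin p,
      (X (tI p 0 r) * Y (tI p 3 r) - X (tI p 3 r) * Y (tI p 0 r)
        + X (tI p 1 r) * Y (tI p 2 r) - X (tI p 2 r) * Y (tI p 1 r))) • xi p 2

/-- `dη_i(X, Y) := -η_i([X, Y])`. -/
def dEta (p : ℕ) (lam : ℝ) (i : Fin 3) (X Y : NV p) : ℝ := -(bracket p lam X Y (zI p i))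

/-- The three almost contact endomorphisms `φ₁, φ₂, φ₃` of `n_p`. -/
def phi (p : ℕ) : Fin 3 → NV p → NV p :=
  ![fun X => X (zI p 1) • xi p 2 - X (zI p 2) • xi p 1
      + ∑ r : Fin p, (X (tI p 0 r) • tau p 1 r - X (tI p 1 r) • tau p 0 r
          + X (tI p 2 r) • tau p 3 r - X (tI p 3 r) • tau p 2 r),
    fun X => X (zI p 2) • xi p 0 - X (zI p 0) • xi p 2
      + ∑ r : Fin p, (X (tI p 0 r) • tau p 2 r - X (tI p 2 r) • tau p 0 r
          + X (tI p 3 r) • tau p 1 r - X (tI p 1 r) • tau p 3 r),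
    fun X => X (zI p 0) • xi p 1 - X (zI p 1) • xi p 0
      + ∑ r : Fin p, (X (tI p 0 r) • tau p 3 r - X (tI p 3 r) • tau p 0 r
          + X (tI p 1 r) • tau p 2 r - X (tI p 2 r) • tau p 1 r)]

/-- `(η_i ∧ η_j)(X, Y)`. -/
def etaWedge (p : ℕ) (i j : Fin 3) (X Y : NV p) : ℝ :=
  X (zI p i) * Y (zI p j) - Y (zI p i) * X (zI p j)

/-- The 2-forms `H₁ = -(1/λ)dη₁ + 2 η₂∧η₃`, `H₂ = -(1/λ)dη₂ - 2 η₁∧η₃`,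
`H₃ = -(1/λ)dη₃ + 2 η₁∧η₂`. -/
def Hform (p : ℕ) (lam : ℝ) : Fin 3 → NV p → NV p → ℝ :=
  ![fun X Y => -(1 / lam) * dEta p lam 0 X Y + 2 * etaWedge p 1 2 X Y,
    fun X Y => -(1 / lam) * dEta p lam 1 X Y - 2 * etaWedge p 0 2 X Y,
    fun X Y => -(1 / lam) * dEta p lam 2 X Y + 2 * etaWedge p 0 1 X Y]

/-- The 2-form `H_i` regarded as an endomorphism of `n_p` via `g_λ(H_i X, Y) = H_i(X, Y)`. -/
def Hend (p : ℕ) (lam : ℝ) (i : Fin 3) (X : NV p) : NV p :=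
  fun b => Hform p lam i X (Pi.single b 1)

/-- `(η₁ ∧ η₂ ∧ η₃)(X, Y, Z)`. -/
def det3 (p : ℕ) (X Y Z : NV p) : ℝ :=
  X (zI p 0) * (Y (zI p 1) * Z (zI p 2) - Y (zI p 2) * Z (zI p 1))
  - Y (zI p 0) * (X (zI p 1) * Z (zI p 2) - X (zI p 2) * Z (zI p 1))
  + Z (zI p 0) * (X (zI p 1) * Y (zI p 2) - X (zI p 2) * Y (zI p 1))

/-- The torsion 3-form `T = η₁∧dη₁ + η₂∧dη₂ + η₃∧dη₃ - 4λ η₁∧η₂∧η₃`. -/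
def Tform (p : ℕ) (lam : ℝ) (X Y Z : NV p) : ℝ :=
  (∑ i : Fin 3,
    (X (zI p i) * dEta p lam i Y Z - Y (zI p i) * dEta p lam i X Z
      + Z (zI p i) * dEta p lam i X Y)) - 4 * lam * det3 p X Y Z

/-- The standard basis vector `e_a` of `n_p`. -/
def basisE (p : ℕ) (a : Fin (4 * p + 3)) : NV p := Pi.single a 1

end

@[simp] lemma tI_inj {p : ℕ} {i j : Fin 4} {r s : Fin p} :
    tI p i r = tI p j s ↔ i = j ∧ r = s := by
  refine ⟨fun h => ?_, fun ⟨hi, hr⟩ => by rw [hi, hr]⟩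
  have h' : i.val * p + r.val = j.val * p + s.val := by
    simp only [tI, Fin.mk.injEq] at h
    omega
  have hp : 0 < p := r.pos
  have hi : i = j := Fin.ext <| by
    simpa [Nat.add_div_of_dvd_right, Nat.div_eq_of_lt, hp.ne'] using congrArg (fun n => n / p) h'
  subst hi
  exact ⟨rfl, Fin.ext (by omega)⟩

@[simp] lemma zI_inj {p : ℕ} {i j : Fin 3} : zI p i = zI p j ↔ i = j := by
  simp [zI, Fin.ext_iff]

@[simp] lemma zI_ne_tI {p : ℕ} (i : Fin 3) (j : Fin 4) (r : Fin p) : zI p i ≠ tI p j r := by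
  have := i.isLt
  simp only [zI, tI, ne_eq, Fin.mk.injEq]
  omega

@[simp] lemma tau_tI {p : ℕ} (i j : Fin 4) (r s : Fin p) :
    tau p i r (tI p j s) = if j = i ∧ s = r then 1 else 0 := by
  simp [tau, Pi.single_apply]

@[simp] lemma xi_zI {p : ℕ} (i j : Fin 3) : xi p i (zI p j) = if j = i then 1 else 0 := by
  simp [xi, Pi.single_apply]

@[simp] lemma xi_tI {p : ℕ} (i : Fin 3) (j : Fin 4) (r : Fin p) : xi p i (tI p j r) = 0 := by
  simp [xi, (zI_ne_tI i j r).symm]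

/-- The vectors `ξ_i` are central. -/
@[simp] lemma bracket_xi_right {p : ℕ} (lam : ℝ) (X : NV p) (i : Fin 3) :
    bracket p lam X (xi p i) = 0 := by
  simp [bracket]

@[simp] lemma bracket_xi_left {p : ℕ} (lam : ℝ) (X : NV p) (i : Fin 3) :
    bracket p lam (xi p i) X = 0 := by
  simp [bracket]

@[simp] lemma gIP_zero_left {p : ℕ} (V : NV p) : gIP 0 V = 0 := by
  simp [gIP]

@[simp] lemma gIP_smul_xi {p : ℕ} (c : ℝ) (i : Fin 3) (V : NV p) :
    gIP (c • xi p i) V = c * V (zI p i) := by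
  simp [gIP, xi, Pi.single_apply]

/-- `[τ_r, τ_{(j+1)p+r}] = λ ξ_{j+1}` for `j = 0, 1, 2`. -/
lemma bracket_tau_zero_tau_succ {p : ℕ} (lam : ℝ) (j : Fin 3) (r : Fin p) :
    bracket p lam (tau p 0 r) (tau p j.succ r) = lam • xi p j := by
  fin_cases j <;> simp [bracket]

/-- `φ_i ξ_{i+2} = -ξ_{i+1}`, with indices modulo `3`. -/
lemma phi_xi_add_two {p : ℕ} (i : Fin 3) : phi p i (xi p (i + 2)) = -xi p (i + 1) := by
  fin_cases i <;> simp [phi]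

/-- for each `i = 1, 2, 3` the fundamental 2-form `Fᵢ(X,Y) = g_λ(X, φᵢY)` is not
closed (so none of the three normal almost contact structures is quasi-Sasakian):
there are `X, Y, Z` with `dFᵢ(X,Y,Z) = -Fᵢ([X,Y],Z) - Fᵢ([Y,Z],X) - Fᵢ([Z,X],Y) ≠ 0`. -/
theorem quaternionic_heisenberg_fundamental_form_not_closed
    (p : ℕ) (hp : 1 ≤ p) (lam : ℝ) (hlam : 0 < lam) :
    ∀ i : Fin 3, ∃ X Y Z : NV p,
      -(gIP (bracket p lam X Y) (phi p i Z))
        - gIP (bracket p lam Y Z) (phi p i X)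
        - gIP (bracket p lam Z X) (phi p i Y) ≠ 0 := by
  intro i
  refine ⟨tau p 0 ⟨0, hp⟩, tau p (i + 1).succ ⟨0, hp⟩, xi p (i + 2), ?_⟩
  rw [bracket_tau_zero_tau_succ, phi_xi_add_two]
  simpa using hlam.ne'
end

section
/- The linear map Ω : n_p → End(n_p) defined by Ω(ξᵢ) = −λHᵢ (i = 1, 2, 3) and Ω(τₗ) = 0 (l = 1, …, 4p) is the metric connection with skew torsion T: for all X, Y, Z ∈ n_p, g_λ(Ω(X)Y, Z) = ½[g_λ([X, Y], Z) − g_λ([Y, Z], X) + g_λ([Z, X], Y)] + ½·T(X, Y, Z), where the first bracket equals g_λ(∇^g_X Y, Z) for the Levi-Civita connection ∇^g of the left-invariant metric g_λ. -/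
theorem zI_injective (p : ℕ) : Function.Injective (zI p) := fun _ _ h =>
  Fin.ext (Fin.mk.inj h)

theorem exists_eq_tI_of_notMem_range_zI {p : ℕ} {a : Fin (4 * p + 3)}
    (ha : a ∉ Set.range (zI p)) : ∃ i r, a = tI p i r := by
  have h3 : 3 ≤ a.val := by
    by_contra! h
    exact ha ⟨⟨a.val, h⟩, rfl⟩
  have hlt : a.val - 3 < p * 4 := by omega
  have hp : 0 < p := by omega
  refine ⟨⟨(a.val - 3) / p, Nat.div_lt_of_lt_mul hlt⟩,
    ⟨(a.val - 3) % p, Nat.mod_lt _ hp⟩, Fin.ext ?_⟩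
  have := Nat.div_add_mod' (a.val - 3) p
  simp only [tI]
  omega

theorem bracket_eq_sum_xi (p : ℕ) (lam : ℝ) (X Y : NV p) :
    bracket p lam X Y = ∑ i, bracket p lam X Y (zI p i) • xi p i := by
  simp [bracket, Fin.sum_univ_three, xi, Pi.single_apply, (zI_injective p).eq_iff]

theorem gIP_bracket (p : ℕ) (lam : ℝ) (X Y Z : NV p) :
    gIP (bracket p lam X Y) Z = ∑ i, bracket p lam X Y (zI p i) * Z (zI p i) := by
  rw [bracket_eq_sum_xi]
  simp [gIP, xi, Finset.sum_mul, Pi.single_apply, (zI_injective p).eq_iff,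
    Finset.sum_comm (s := (Finset.univ : Finset (Fin (4 * p + 3))))]

theorem bracket_swap (p : ℕ) (lam : ℝ) (X Y : NV p) :
    bracket p lam Y X = -bracket p lam X Y := by
  ext b
  simp only [bracket, Pi.add_apply, Pi.neg_apply, Pi.smul_apply, smul_eq_mul,
    Finset.sum_add_distrib, Finset.sum_sub_distrib, mul_comm (Y _) (X _)]
  ring

theorem isLinearMap_bracket (p : ℕ) (lam : ℝ) (X : NV p) :
    IsLinearMap ℝ (bracket p lam X) where
  map_add Y Z := by
    ext b
    simp only [bracket, Pi.add_apply, Pi.smul_apply, smul_eq_mul, mul_add,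
      Finset.sum_add_distrib, Finset.sum_sub_distrib]
    ring
  map_smul c Y := by
    ext b
    simp only [bracket, Pi.add_apply, Pi.smul_apply, smul_eq_mul, mul_left_comm (X _) c,
      ← mul_sub, ← mul_add, ← Finset.mul_sum]
    ring

theorem isLinearMap_Hform (p : ℕ) (lam : ℝ) (i : Fin 3) (X : NV p) :
    IsLinearMap ℝ (Hform p lam i X) where
  map_add Y Z := by
    fin_cases i <;>
      simp [Hform, dEta, etaWedge, (isLinearMap_bracket p lam X).map_add] <;> ring
  map_smul c Y := by
    fin_cases i <;>
      simp [Hform, dEta, etaWedge, (isLinearMap_bracket p lam X).map_smul] <;> ring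

theorem IsLinearMap.apply_eq_sum_single {ι M : Type*} [Fintype ι] [DecidableEq ι]
    [AddCommMonoid M] [Module ℝ M] {f : (ι → ℝ) → M} (hf : IsLinearMap ℝ f) (x : ι → ℝ) :
    f x = ∑ i, x i • f (Pi.single i 1) := by
  conv_lhs => rw [pi_eq_sum_univ' x]
  rw [← IsLinearMap.mk'_apply hf, map_sum]
  simp

theorem gIP_Hend (p : ℕ) (lam : ℝ) (i : Fin 3) (X Y : NV p) :
    gIP (Hend p lam i X) Y = Hform p lam i X Y := by
  rw [(isLinearMap_Hform p lam i X).apply_eq_sum_single Y]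
  simp [gIP, Hend, mul_comm]

/-- A linear map on `n_p` killing every `τ_l` is determined by its values on the `ξ_i`. -/
theorem IsLinearMap.apply_eq_sum_xi {p : ℕ} {M : Type*} [AddCommMonoid M] [Module ℝ M]
    {f : NV p → M} (hf : IsLinearMap ℝ f) (hτ : ∀ i r, f (tau p i r) = 0) (X : NV p) :
    f X = ∑ i, X (zI p i) • f (xi p i) := by
  rw [hf.apply_eq_sum_single X]
  refine (Fintype.sum_of_injective (zI p) (zI_injective p) _ _ (fun a ha => ?_)
    fun i => rfl).symm
  obtain ⟨i, r, rfl⟩ := exists_eq_tI_of_notMem_range_zI ha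
  exact (congrArg _ (hτ i r)).trans (smul_zero _)

/-- the map `Ω` with `Ω(ξᵢ) = -λHᵢ`, `Ω(τₗ) = 0` is the metric connection with
skew torsion `T`:
`g_λ(Ω(X)Y, Z) = ½[g_λ([X,Y],Z) - g_λ([Y,Z],X) + g_λ([Z,X],Y)] + ½T(X,Y,Z)`. -/
theorem quaternionic_heisenberg_Om_is_metric_connection_with_torsion
    (p : ℕ) (hp : 1 ≤ p) (lam : ℝ) (hlam : 0 < lam)
    (Om : NV p → NV p → NV p)
    (hOmLin : ∀ (c : ℝ) (X X' Y : NV p), Om (c • X + X') Y = c • Om X Y + Om X' Y)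
    (hOmXi : ∀ i : Fin 3, ∀ Y : NV p, Om (xi p i) Y = -(lam • Hend p lam i Y))
    (hOmTau : ∀ (i : Fin 4) (r : Fin p), ∀ Y : NV p, Om (tau p i r) Y = 0) :
    ∀ X Y Z : NV p,
      gIP (Om X Y) Z
        = (gIP (bracket p lam X Y) Z - gIP (bracket p lam Y Z) X
            + gIP (bracket p lam Z X) Y) / 2
          + Tform p lam X Y Z / 2 := by
  intro X Y Z
  have hadd (X X' Y : NV p) : Om (X + X') Y = Om X Y + Om X' Y := by
    simpa using hOmLin 1 X X' Y
  have hzero (Y : NV p) : Om 0 Y = 0 := by simpa using hadd 0 0 Y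
  have hlin : IsLinearMap ℝ fun X => Om X Y :=
    ⟨fun X X' => hadd X X' Y, fun c X => by simpa [hzero] using hOmLin c X 0 Y⟩
  have hOm : gIP (Om X Y) Z = -∑ i, X (zI p i) * (lam * Hform p lam i Y Z) := by
    rw [hlin.apply_eq_sum_xi (fun i r => hOmTau i r Y) X]
    simp only [hOmXi, ← gIP_Hend, gIP, Finset.sum_apply, Pi.smul_apply, Pi.neg_apply,
      smul_eq_mul, Finset.sum_mul, Finset.mul_sum, ← Finset.sum_neg_distrib]
    rw [Finset.sum_comm]
    refine Finset.sum_congr rfl fun i _ => Finset.sum_congr rfl fun a _ => by ring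
  rw [hOm, gIP_bracket, gIP_bracket, gIP_bracket, bracket_swap p lam X Z]
  simp only [Tform, Hform, dEta, etaWedge, det3, Fin.sum_univ_three, Pi.neg_apply,
    Matrix.cons_val]
  field_simp
  ring
end
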